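/- In the time-homogeneous case (G_n = G for all n ≥ 0, M_n = M for all n ≥ 1), assume (H0) and (H). Let η_∞ be the unique fixed point of Φ, satisfying ||Φ^n(η_0) − η_∞||_tv ≤ a b e^{−λn} for all n ≥ 0, and let h be defined by log h(x) := Σ_{n≥0} [log Φ^n(δ_x)(G) − log Φ^n(η_∞)(G)]. Then there exists a finite constant c, depending only on a, λ, g, such that for all p ≥ 0, ||Q̄_{p,∞}(1) − h||_∞ ≤ c e^{−λp}. -/

import Mathlib

open MeasureTheory ProbabilityTheory Filter

noncomputable section

namespace FKCLT

variable {E : Type*} [MeasurableSpace E]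

/-- Oscillation of a real-valued function. -/
def osc (f : E → ℝ) : ℝ := ⨆ p : E × E, |f p.1 - f p.2|

/-- Total variation distance between two (finite) measures. -/
def tvDist (μ ν : Measure E) : ℝ := ⨆ s : Set E, |(μ s).toReal - (ν s).toReal|

/-- Normalization of a finite nonzero measure. -/
def normalize (μ : Measure E) : Measure E := (μ Set.univ)⁻¹ • μ

variable (M : ℕ → Kernel E E) (G : ℕ → E → ℝ)

/-- `Qmeas M G p n x` : the Feynman-Kac measure `A ↦ 𝔼[1_A(X_n) ∏_{p≤q<n} G_q(X_q) | X_p = x]`. -/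
def Qmeas (p n : ℕ) (x : E) : Measure E :=
  if h : p < n then
    ENNReal.ofReal (G p x) • Measure.bind ((M (p + 1)) x) (fun z => Qmeas (p + 1) n z)
  else Measure.dirac x
termination_by n - p
decreasing_by omega

/-- `Q_{p,n}(f)(x)`. -/
def Qop (p n : ℕ) (f : E → ℝ) (x : E) : ℝ := ∫ z, f z ∂(Qmeas M G p n x)

variable (η0 : Measure E)

/-- The normalized Feynman-Kac measure `η_n` (with the convention `η_{-1} := η_0`,
realized by `n - 1 = 0` in `ℕ` for `n = 0`). -/
def etaFK (n : ℕ) : Measure E := normalize (Measure.bind η0 (Qmeas M G 0 n))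

/-- `Q̄_{p,n}(f) = Q_{p,n}(f) / η_p(Q_{p,n}(1))`. -/
def Qbar (p n : ℕ) (f : E → ℝ) (x : E) : ℝ :=
  Qop M G p n f x / ∫ y, Qop M G p n (fun _ => 1) y ∂(etaFK M G η0 p)

/-- `d_{p,n}(f) = Q̄_{p,n}(f - η_n(f))`. -/
def dFK (p n : ℕ) (f : E → ℝ) (x : E) : ℝ :=
  Qbar M G η0 p n (fun z => f z - ∫ w, f w ∂(etaFK M G η0 n)) x

/-- `Ḡ_n = G_n / η_n(G_n)`. -/
def Gbar (n : ℕ) (x : E) : ℝ := G n x / ∫ z, G n z ∂(etaFK M G η0 n)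

/-- `Φ_{p,n}(μ)`. -/
def PhiFK (p n : ℕ) (μ : Measure E) : Measure E := normalize (Measure.bind μ (Qmeas M G p n))

/-- `Φ_n`, with the convention `Φ_0(μ) = η_0`. -/
def PhiStep (n : ℕ) (μ : Measure E) : Measure E :=
  if n = 0 then η0 else PhiFK M G (n - 1) n μ

/-- The Markov kernel `P_{p,n}(x, ·) = Q_{p,n}(x,·)/Q_{p,n}(1)(x)`. -/
def PFK (p n : ℕ) (x : E) : Measure E := normalize (Qmeas M G p n x)

/-- The covariance functional `Cov_{n,μ}(f1, f2)`. -/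
def CovFn (K : ℕ → Measure E → Kernel E E) (n : ℕ) (μ : Measure E) (f1 f2 : E → ℝ) : ℝ :=
  ∫ x, ((∫ z, f1 z * f2 z ∂((K n μ) x)) -
    (∫ z, f1 z ∂((K n μ) x)) * (∫ z, f2 z ∂((K n μ) x))) ∂μ

/-- `v_n = Σ_{0 ≤ q < n} Cov_{q, η_{q-1}}(Q̄_{q,n}(1), Q̄_{q,n}(1))`. -/
def vFK (K : ℕ → Measure E → Kernel E E) (n : ℕ) : ℝ :=
  ∑ q ∈ Finset.range n,
    CovFn K q (etaFK M G η0 (q - 1)) (Qbar M G η0 q n (fun _ => 1)) (Qbar M G η0 q n (fun _ => 1))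

/-- Empirical measure of an `N`-tuple of points. -/
def empMeas {N : ℕ} (x : Fin N → E) : Measure E :=
  (N : ENNReal)⁻¹ • ∑ i : Fin N, Measure.dirac (x i)

variable {Ω : Type*} [MeasurableSpace Ω]

/-- σ-algebra generated by the particle system up to time `n`. -/
def partFilt {N : ℕ} (ξ : ℕ → Ω → (Fin N → E)) (n : ℕ) : MeasurableSpace Ω :=
  ⨆ k ∈ Finset.range (n + 1), MeasurableSpace.comap (ξ k) inferInstance

/-- Local error fields `V_n^N`. -/
def VN {N : ℕ} (ξ : ℕ → Ω → (Fin N → E)) (n : ℕ) (f : E → ℝ) (ω : Ω) : ℝ :=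
  Real.sqrt N * ((∫ z, f z ∂(empMeas (ξ n ω))) -
    ∫ z, f z ∂(PhiStep M G η0 n (empMeas (ξ (n - 1) ω))))

/-- Global error fields `W_n^N`. -/
def WN {N : ℕ} (ξ : ℕ → Ω → (Fin N → E)) (n : ℕ) (f : E → ℝ) (ω : Ω) : ℝ :=
  Real.sqrt N * ((∫ z, f z ∂(empMeas (ξ n ω))) - ∫ z, f z ∂(etaFK M G η0 n))

/-- `L^m` norm of a real random variable. -/
def LmNorm (P : Measure Ω) (m : ℕ) (X : Ω → ℝ) : ℝ := (∫ ω, |X ω| ^ m ∂P) ^ ((m : ℝ)⁻¹)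


/-- The summand log Φ_{p,q}(δ_x)(G_q) - log Φ_{p,q}(η_p)(G_q). -/
def logTermFK (p q : ℕ) (x : E) : ℝ :=
  Real.log (∫ z, G q z ∂(PhiFK M G p q (Measure.dirac x))) -
    Real.log (∫ z, G q z ∂(PhiFK M G p q (etaFK M G η0 p)))

/-- The limiting function Q̄_{p,∞}(1), defined through the series (def-Qinfty). -/
def QbarInf (p : ℕ) (x : E) : ℝ := Real.exp (∑' k : ℕ, logTermFK M G η0 p (p + k) x)

/-- The one-step map Φ of a time-homogeneous model. -/
def PhiHom (M1 : Kernel E E) (G1 : E → ℝ) (μ : Measure E) : Measure E :=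
  PhiFK (fun _ => M1) (fun _ => G1) 0 1 μ

/-- The ground state function h, log h(x) = Σ_n [log Φ^n(δ_x)(G) - log Φ^n(η_∞)(G)]. -/
def hHom (M1 : Kernel E E) (G1 : E → ℝ) (ηinf : Measure E) (x : E) : ℝ :=
  Real.exp (∑' n : ℕ,
    (Real.log (∫ z, G1 z ∂((PhiHom M1 G1)^[n] (Measure.dirac x))) -
      Real.log (∫ z, G1 z ∂((PhiHom M1 G1)^[n] ηinf))))


/-! ### Total variation and normalization -/

lemma toReal_mem_Icc (μ : Measure E) [IsProbabilityMeasure μ] (s : Set E) :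
    (μ s).toReal ∈ Set.Icc (0 : ℝ) 1 :=
  ⟨ENNReal.toReal_nonneg, measureReal_le_one (μ := μ) (s := s)⟩

lemma abs_toReal_sub_le_one (μ ν : Measure E) [IsProbabilityMeasure μ] [IsProbabilityMeasure ν]
    (s : Set E) : |(μ s).toReal - (ν s).toReal| ≤ 1 := by
  obtain ⟨h1, h2⟩ := toReal_mem_Icc μ s
  obtain ⟨h3, h4⟩ := toReal_mem_Icc ν s
  rw [abs_le]
  constructor <;> linarith

lemma abs_toReal_sub_le_tvDist (μ ν : Measure E) [IsProbabilityMeasure μ]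
    [IsProbabilityMeasure ν] (s : Set E) : |(μ s).toReal - (ν s).toReal| ≤ tvDist μ ν :=
  le_ciSup (f := fun s : Set E => |(μ s).toReal - (ν s).toReal|)
    ⟨1, by rintro _ ⟨s, rfl⟩; exact abs_toReal_sub_le_one μ ν s⟩ s

lemma tvDist_nonneg (μ ν : Measure E) : 0 ≤ tvDist μ ν :=
  Real.iSup_nonneg fun _ => abs_nonneg _

lemma tvDist_comm (μ ν : Measure E) : tvDist μ ν = tvDist ν μ := by
  simp only [tvDist, abs_sub_comm]

lemma tvDist_le_one (μ ν : Measure E) [IsProbabilityMeasure μ] [IsProbabilityMeasure ν] :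
    tvDist μ ν ≤ 1 :=
  ciSup_le (abs_toReal_sub_le_one μ ν)

/-- To bound the total variation distance it is enough to look at measurable sets. -/
lemma tvDist_le_of_measurableSet {μ ν : Measure E} [IsFiniteMeasure μ] [IsFiniteMeasure ν] {c : ℝ}
    (h : ∀ s, MeasurableSet s → |(μ s).toReal - (ν s).toReal| ≤ c) : tvDist μ ν ≤ c := by
  refine ciSup_le fun s => ?_
  have hm : (μ s) = μ (toMeasurable (μ + ν) s) := by
    simpa using (Measure.measure_toMeasurable_add_inter_left (μ := μ) (ν := ν) (t := s)
      MeasurableSet.univ (measure_ne_top _ _)).symm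
  have hn : (ν s) = ν (toMeasurable (μ + ν) s) := by
    simpa using (Measure.measure_toMeasurable_add_inter_right (μ := μ) (ν := ν) (t := s)
      MeasurableSet.univ (measure_ne_top _ _)).symm
  rw [hm, hn]
  exact h _ (measurableSet_toMeasurable _ _)

lemma integrable_of_bounded {μ : Measure E} [IsFiniteMeasure μ] {f : E → ℝ}
    (hf : Measurable f) {F : ℝ} (h0 : ∀ x, 0 ≤ f x) (hF : ∀ x, f x ≤ F) : Integrable f μ :=
  Integrable.of_bound hf.aestronglyMeasurable F
    (ae_of_all _ fun x => by rw [Real.norm_of_nonneg (h0 x)]; exact hF x)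

lemma abs_integral_sub_le {μ ν : Measure E} [IsProbabilityMeasure μ] [IsProbabilityMeasure ν]
    {f : E → ℝ} (hf : Measurable f) {F : ℝ} (hF0 : 0 ≤ F) (h0 : ∀ x, 0 ≤ f x)
    (hF : ∀ x, f x ≤ F) : |∫ x, f x ∂μ - ∫ x, f x ∂ν| ≤ F * tvDist μ ν := by
  have layer : ∀ (ρ : Measure E) [IsProbabilityMeasure ρ],
      ∫ x, f x ∂ρ = ∫ t in Set.Ioc 0 F, ρ.real {a | t ≤ f a} := fun ρ _ =>
    Integrable.integral_eq_integral_Ioc_meas_le (integrable_of_bounded hf h0 hF)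
      (ae_of_all _ h0) (ae_of_all _ hF)
  have hint : ∀ (ρ : Measure E) [IsProbabilityMeasure ρ],
      Integrable (fun t => ρ.real {a | t ≤ f a}) (volume.restrict (Set.Ioc 0 F)) := by
    intro ρ _
    refine integrable_of_bounded (F := 1) ?_ (fun _ => measureReal_nonneg)
      (fun _ => measureReal_le_one)
    refine Antitone.measurable fun s t hst => ?_
    exact measureReal_mono fun a (ha : t ≤ f a) => hst.trans ha
  rw [layer μ, layer ν, ← integral_sub (hint μ) (hint ν)]
  have := norm_setIntegral_le_of_norm_le_const (μ := volume) (s := Set.Ioc (0 : ℝ) F)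
    (f := fun t => μ.real {a | t ≤ f a} - ν.real {a | t ≤ f a}) (C := tvDist μ ν)
    (by simp) (fun t _ => abs_toReal_sub_le_tvDist μ ν {a | t ≤ f a})
  rw [Real.norm_eq_abs] at this
  refine this.trans (le_of_eq ?_)
  simp [Measure.real, hF0, mul_comm]

lemma isProbabilityMeasure_normalize {μ : Measure E} (h0 : μ Set.univ ≠ 0)
    (h1 : μ Set.univ ≠ ⊤) : IsProbabilityMeasure (normalize μ) :=
  ⟨by simp [normalize, ENNReal.inv_mul_cancel h0 h1]⟩

lemma normalize_eq_self (μ : Measure E) [IsProbabilityMeasure μ] : normalize μ = μ := by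
  simp [normalize]

lemma normalize_smul {μ : Measure E} {c : ENNReal} (h0 : c ≠ 0) (h1 : c ≠ ⊤) :
    normalize (c • μ) = normalize μ := by
  simp only [normalize, Measure.smul_apply, smul_eq_mul, smul_smul]
  rw [ENNReal.mul_inv (Or.inl h0) (Or.inl h1), mul_right_comm, ENNReal.inv_mul_cancel h0 h1,
    one_mul]

lemma smul_univ_normalize {μ : Measure E} (h0 : μ Set.univ ≠ 0) (h1 : μ Set.univ ≠ ⊤) :
    μ Set.univ • normalize μ = μ := by
  simp [normalize, smul_smul, ENNReal.mul_inv_cancel h0 h1]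

/-- A positive function whose ratios are bounded by `B`. -/
structure RatioBounded (f : E → ℝ) (B : ℝ) : Prop where
  measurable : Measurable f
  pos : ∀ x, 0 < f x
  ratio : ∀ x y, f x ≤ B * f y

namespace RatioBounded

variable {f : E → ℝ} {B : ℝ}

lemma one_le [Nonempty E] (hf : RatioBounded f B) : 1 ≤ B := by
  obtain ⟨x⟩ := ‹Nonempty E›
  exact (le_mul_iff_one_le_left (hf.pos x)).1 (hf.ratio x x)

lemma integrable [Nonempty E] (hf : RatioBounded f B) (μ : Measure E) [IsFiniteMeasure μ] :
    Integrable f μ := by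
  obtain ⟨y⟩ := ‹Nonempty E›
  exact integrable_of_bounded hf.measurable (fun x => (hf.pos x).le) (fun x => hf.ratio x y)

lemma le_integral [Nonempty E] (hf : RatioBounded f B) (μ : Measure E) [IsProbabilityMeasure μ]
    (y : E) : f y ≤ B * ∫ x, f x ∂μ := by
  have h : ∫ _, f y ∂μ ≤ ∫ x, B * f x ∂μ :=
    integral_mono (integrable_const _) ((hf.integrable μ).const_mul _) fun x => hf.ratio y x
  simpa [integral_const_mul] using h

lemma integral_pos [Nonempty E] (hf : RatioBounded f B) (μ : Measure E)
    [IsProbabilityMeasure μ] : 0 < ∫ x, f x ∂μ := by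
  obtain ⟨y⟩ := ‹Nonempty E›
  have h1 := (hf.pos y).trans_le (hf.le_integral μ y)
  exact pos_of_mul_pos_right h1 (zero_le_one.trans hf.one_le)

lemma abs_integral_sub_le_mul_integral [Nonempty E] (hf : RatioBounded f B) (μ ν ρ : Measure E)
    [IsProbabilityMeasure μ] [IsProbabilityMeasure ν] [IsProbabilityMeasure ρ]
    {k : E → ℝ} (hk : Measurable k) (hk0 : ∀ x, 0 ≤ k x) (hkf : ∀ x, k x ≤ f x) :
    |∫ x, k x ∂μ - ∫ x, k x ∂ν| ≤ B ^ 2 * tvDist μ ν * ∫ x, f x ∂ρ := by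
  have hB := hf.one_le
  have hbd : ∀ x, k x ≤ B ^ 2 * ∫ x, f x ∂ρ := fun x => by
    have h1 := hf.le_integral ρ x
    have h2 := hf.integral_pos ρ
    nlinarith [hkf x, mul_nonneg (sub_nonneg.2 hB) (mul_pos (zero_lt_one.trans_le hB) h2).le]
  have := abs_integral_sub_le (μ := μ) (ν := ν) hk
    (mul_nonneg (sq_nonneg B) (hf.integral_pos ρ).le) hk0 hbd
  linarith

lemma log_integral_sub_le [Nonempty E] (hf : RatioBounded f B) (μ ν : Measure E)
    [IsProbabilityMeasure μ] [IsProbabilityMeasure ν] :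
    Real.log (∫ x, f x ∂μ) - Real.log (∫ x, f x ∂ν) ≤ B ^ 2 * tvDist μ ν := by
  have hμ := hf.integral_pos μ
  have hν := hf.integral_pos ν
  have h := (abs_le.1 (hf.abs_integral_sub_le_mul_integral μ ν ν hf.measurable
    (fun x => (hf.pos x).le) fun x => le_rfl)).2
  rw [← Real.log_div hμ.ne' hν.ne']
  refine (Real.log_le_sub_one_of_pos (div_pos hμ hν)).trans ?_
  rw [div_sub_one hν.ne', div_le_iff₀ hν]
  exact h

lemma abs_log_integral_sub_le [Nonempty E] (hf : RatioBounded f B) (μ ν : Measure E)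
    [IsProbabilityMeasure μ] [IsProbabilityMeasure ν] :
    |Real.log (∫ x, f x ∂μ) - Real.log (∫ x, f x ∂ν)| ≤ B ^ 2 * tvDist μ ν := by
  have h1 := hf.log_integral_sub_le μ ν
  have h2 := hf.log_integral_sub_le ν μ
  rw [tvDist_comm ν μ] at h2
  exact abs_sub_le_iff.2 ⟨h1, h2⟩

lemma withDensity_toReal [Nonempty E] (hf : RatioBounded f B) (μ : Measure E)
    [IsFiniteMeasure μ] {s : Set E} (hs : MeasurableSet s) :
    (μ.withDensity (fun x => ENNReal.ofReal (f x)) s).toReal = ∫ x, s.indicator f x ∂μ := by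
  rw [withDensity_apply _ hs, integral_indicator hs,
    integral_eq_lintegral_of_nonneg_ae (ae_of_all _ fun x => (hf.pos x).le)
      hf.measurable.aestronglyMeasurable]

lemma withDensity_univ [Nonempty E] (hf : RatioBounded f B) (μ : Measure E)
    [IsFiniteMeasure μ] :
    μ.withDensity (fun x => ENNReal.ofReal (f x)) Set.univ = ENNReal.ofReal (∫ x, f x ∂μ) := by
  rw [withDensity_apply _ MeasurableSet.univ, Measure.restrict_univ,
    ofReal_integral_eq_lintegral_ofReal (hf.integrable μ) (ae_of_all _ fun x => (hf.pos x).le)]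

lemma isProbabilityMeasure_normalize_withDensity [Nonempty E] (hf : RatioBounded f B)
    (μ : Measure E) [IsProbabilityMeasure μ] :
    IsProbabilityMeasure (normalize (μ.withDensity fun x => ENNReal.ofReal (f x))) := by
  apply isProbabilityMeasure_normalize
  · rw [hf.withDensity_univ μ]
    simpa using hf.integral_pos μ
  · rw [hf.withDensity_univ μ]
    exact ENNReal.ofReal_ne_top

lemma normalize_withDensity_toReal [Nonempty E] (hf : RatioBounded f B) (μ : Measure E)
    [IsProbabilityMeasure μ] {s : Set E} (hs : MeasurableSet s) :
    (normalize (μ.withDensity (fun x => ENNReal.ofReal (f x))) s).toReal =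
      (∫ x, s.indicator f x ∂μ) / ∫ x, f x ∂μ := by
  rw [normalize, hf.withDensity_univ μ, Measure.smul_apply, smul_eq_mul, ENNReal.toReal_mul,
    hf.withDensity_toReal μ hs, ENNReal.toReal_inv,
    ENNReal.toReal_ofReal (hf.integral_pos μ).le, inv_mul_eq_div]

/-- Boltzmann-Gibbs transformations with a ratio-bounded density are Lipschitz in total
variation. -/
lemma tvDist_normalize_withDensity_le [Nonempty E] (hf : RatioBounded f B) (μ ν : Measure E)
    [IsProbabilityMeasure μ] [IsProbabilityMeasure ν] :
    tvDist (normalize (μ.withDensity fun x => ENNReal.ofReal (f x)))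
      (normalize (ν.withDensity fun x => ENNReal.ofReal (f x))) ≤ 2 * B ^ 2 * tvDist μ ν := by
  have := hf.isProbabilityMeasure_normalize_withDensity μ
  have := hf.isProbabilityMeasure_normalize_withDensity ν
  refine tvDist_le_of_measurableSet fun s hs => ?_
  rw [hf.normalize_withDensity_toReal μ hs, hf.normalize_withDensity_toReal ν hs]
  have hk0 : ∀ x, 0 ≤ s.indicator f x := Set.indicator_nonneg fun x _ => (hf.pos x).le
  have hkf : ∀ x, s.indicator f x ≤ f x := fun x =>
    Set.indicator_le_self' (fun x _ => (hf.pos x).le) x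
  have h1 := hf.abs_integral_sub_le_mul_integral μ ν μ (hf.measurable.indicator hs) hk0 hkf
  have h2 := hf.abs_integral_sub_le_mul_integral μ ν μ hf.measurable
    (fun x => (hf.pos x).le) fun x => le_rfl
  have hμ := hf.integral_pos μ
  have hν := hf.integral_pos ν
  have h3 : 0 ≤ ∫ x, s.indicator f x ∂ν := integral_nonneg hk0
  have h4 : ∫ x, s.indicator f x ∂ν ≤ ∫ x, f x ∂ν :=
    integral_mono ((hf.integrable ν).indicator hs) (hf.integrable ν) hkf
  generalize ∫ x, s.indicator f x ∂ν = A at *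
  generalize ∫ x, s.indicator f x ∂μ = C at *
  generalize ∫ x, f x ∂ν = V at *
  generalize ∫ x, f x ∂μ = U at *
  have key : C / U - A / V = (C - A) / U + (A / V) * ((V - U) / U) := by
    field_simp
    ring
  have hAV : A / V ≤ 1 := (div_le_one hν).2 h4
  have e1 : |(C - A) / U| ≤ B ^ 2 * tvDist μ ν := by
    rwa [abs_div, abs_of_pos hμ, div_le_iff₀ hμ]
  have e2 : |(V - U) / U| ≤ B ^ 2 * tvDist μ ν := by
    rwa [abs_div, abs_of_pos hμ, div_le_iff₀ hμ, abs_sub_comm]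
  calc |C / U - A / V| ≤ |(C - A) / U| + |(A / V) * ((V - U) / U)| := by
        rw [key]; exact abs_add_le _ _
    _ = |(C - A) / U| + (A / V) * |(V - U) / U| := by
        rw [abs_mul, abs_of_nonneg (div_nonneg h3 hν.le)]
    _ ≤ |(C - A) / U| + 1 * |(V - U) / U| := by gcongr
    _ ≤ 2 * B ^ 2 * tvDist μ ν := by linarith

end RatioBounded

/-! ### The time-homogeneous Feynman-Kac semigroup -/

section Homogeneous

variable (M1 : Kernel E E) [IsMarkovKernel M1] (G1 : E → ℝ)

/-- The unnormalized one-step kernel `x ↦ G(x) M(x, ·)`. -/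
def stepKernel : Kernel E E := M1.withDensity fun x _ => ENNReal.ofReal (G1 x)

/-- The flow `μ ↦ Φ^n(μ)`, written as the normalization of `μ Q^n`. -/
def fkFlow (n : ℕ) (μ : Measure E) : Measure E :=
  normalize (Measure.bind μ ⇑(stepKernel M1 G1 ^ n))

/-- The mass `Q^n(1)(x)`. -/
def mass (n : ℕ) (x : E) : ℝ :=
  ((stepKernel M1 G1 ^ n) x Set.univ).toReal

/-- The Markov kernel `P_{0,n}` as a function. -/
def normalizedPow (n : ℕ) (x : E) : Measure E :=
  normalize ((stepKernel M1 G1 ^ n) x)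

/-- The kernels `P_{0,n}` contract total variation at rate `a r ^ n`. -/
def Contracts (a r : ℝ) : Prop :=
  ∀ (n : ℕ) (μ ν : Measure E), IsProbabilityMeasure μ → IsProbabilityMeasure ν →
    tvDist (Measure.bind μ (normalizedPow M1 G1 n)) (Measure.bind ν (normalizedPow M1 G1 n)) ≤
      a * r ^ n * tvDist μ ν

variable {M1 G1}

lemma stepKernel_apply (hG : Measurable G1) (x : E) :
    stepKernel M1 G1 x = ENNReal.ofReal (G1 x) • M1 x := by
  rw [stepKernel, Kernel.withDensity_apply _ (by fun_prop), withDensity_const]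

lemma Qmeas_eq_stepKernel_pow (hG : Measurable G1) (n : ℕ) :
    ∀ p : ℕ, Qmeas (fun _ => M1) (fun _ => G1) p (p + n) = ⇑(stepKernel M1 G1 ^ n) := by
  induction n with
  | zero =>
    intro p
    funext x
    rw [Qmeas, dif_neg (by omega), pow_zero]
    exact (Kernel.id_apply x).symm
  | succ n ih =>
    intro p
    funext x
    have h := ih (p + 1)
    rw [add_right_comm, add_assoc] at h
    rw [Qmeas, dif_pos (by omega), h, pow_succ]
    change _ = (_ ∘ₖ _) x
    rw [Kernel.comp_apply, stepKernel_apply hG, Measure.bind_smul]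

lemma PhiFK_eq_flow (hG : Measurable G1) (p n : ℕ) (μ : Measure E) :
    PhiFK (fun _ => M1) (fun _ => G1) p (p + n) μ = fkFlow M1 G1 n μ := by
  rw [PhiFK, Qmeas_eq_stepKernel_pow hG, fkFlow]

lemma bind_stepKernel_pow_succ (n : ℕ) (μ : Measure E) :
    Measure.bind μ ⇑(stepKernel M1 G1 ^ (n + 1)) =
      Measure.bind (Measure.bind μ ⇑(stepKernel M1 G1 ^ n)) (stepKernel M1 G1) := by
  rw [pow_succ', Measure.comp_assoc]
  rfl

lemma bind_stepKernel_univ (hG : Measurable G1) (μ : Measure E) :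
    Measure.bind μ (stepKernel M1 G1) Set.univ = ∫⁻ x, ENNReal.ofReal (G1 x) ∂μ := by
  rw [Measure.bind_apply MeasurableSet.univ (Kernel.aemeasurable _)]
  simp [stepKernel_apply hG]

lemma measurable_mass (n : ℕ) : Measurable (mass M1 G1 n) :=
  (Kernel.measurable_coe _ MeasurableSet.univ).ennreal_toReal

lemma measurable_normalizedPow (n : ℕ) : Measurable (normalizedPow M1 G1 n) := by
  refine Measure.measurable_of_measurable_coe _ fun s hs => ?_
  simp only [normalizedPow, normalize, Measure.smul_apply, smul_eq_mul]
  exact (Kernel.measurable_coe _ MeasurableSet.univ).inv.mul (Kernel.measurable_coe _ hs)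

lemma flow_dirac (n : ℕ) (x : E) :
    fkFlow M1 G1 n (Measure.dirac x) =
      Measure.bind (Measure.dirac x) (normalizedPow M1 G1 n) := by
  rw [fkFlow, Measure.dirac_bind (Kernel.measurable _),
    Measure.dirac_bind (measurable_normalizedPow n), normalizedPow]

variable [Nonempty E] {g : ℝ}

lemma bind_stepKernel_pow_univ (hG : RatioBounded G1 g) (n : ℕ) (μ : Measure E)
    [IsProbabilityMeasure μ] :
    Measure.bind μ ⇑(stepKernel M1 G1 ^ n) Set.univ ≠ 0 ∧
      Measure.bind μ ⇑(stepKernel M1 G1 ^ n) Set.univ ≠ ⊤ := by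
  induction n with
  | zero =>
    have : Measure.bind μ ⇑(stepKernel M1 G1 ^ 0) = μ := Measure.bind_dirac
    rw [this]
    simp
  | succ n ih =>
    rw [bind_stepKernel_pow_succ, bind_stepKernel_univ hG.measurable]
    have : IsFiniteMeasure (Measure.bind μ ⇑(stepKernel M1 G1 ^ n)) := ⟨ih.2.lt_top⟩
    refine ⟨?_, (hG.integrable _).lintegral_lt_top.ne⟩
    rw [Ne, lintegral_eq_zero_iff (by have := hG.measurable; fun_prop)]
    intro h
    have h2 : ∀ᵐ x ∂(Measure.bind μ ⇑(stepKernel M1 G1 ^ n)), False := by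
      filter_upwards [h] with x hx
      have := hG.pos x
      simp at hx
      linarith
    have h3 := ae_iff.1 h2
    simp at h3
    exact ih.1 (by simp [h3])

lemma isProbabilityMeasure_flow (hG : RatioBounded G1 g) (n : ℕ) (μ : Measure E)
    [IsProbabilityMeasure μ] : IsProbabilityMeasure (fkFlow M1 G1 n μ) :=
  isProbabilityMeasure_normalize (bind_stepKernel_pow_univ hG n μ).1
    (bind_stepKernel_pow_univ hG n μ).2

lemma flow_succ (hG : RatioBounded G1 g) (n : ℕ) (μ : Measure E) [IsProbabilityMeasure μ] :
    fkFlow M1 G1 (n + 1) μ = PhiHom M1 G1 (fkFlow M1 G1 n μ) := by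
  have h := bind_stepKernel_pow_univ (M1 := M1) hG n μ
  rw [PhiHom, ← zero_add 1, PhiFK_eq_flow hG.measurable, fkFlow, fkFlow, fkFlow, zero_add,
    bind_stepKernel_pow_succ, pow_one]
  rw [show ∀ ρ : Measure E, Measure.bind (normalize ρ) (stepKernel M1 G1) =
      (ρ Set.univ)⁻¹ • Measure.bind ρ (stepKernel M1 G1) from fun ρ => Measure.bind_smul _ _ _,
    normalize_smul (ENNReal.inv_ne_zero.2 h.2) (ENNReal.inv_ne_top.2 h.1)]

lemma iterate_PhiHom (hG : RatioBounded G1 g) (n : ℕ) (μ : Measure E) [IsProbabilityMeasure μ] :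
    (PhiHom M1 G1)^[n] μ = fkFlow M1 G1 n μ := by
  induction n with
  | zero =>
    have : Measure.bind μ ⇑(stepKernel M1 G1 ^ 0) = μ := Measure.bind_dirac
    rw [fkFlow, this, normalize_eq_self]
    rfl
  | succ n ih => rw [Function.iterate_succ_apply', ih, flow_succ hG]

lemma stepKernel_pow_univ (hG : RatioBounded G1 g) (n : ℕ) (x : E) :
    (stepKernel M1 G1 ^ n) x Set.univ ≠ 0 ∧ (stepKernel M1 G1 ^ n) x Set.univ ≠ ⊤ := by
  simpa [Measure.dirac_bind (Kernel.measurable _)] using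
    bind_stepKernel_pow_univ (M1 := M1) hG n (Measure.dirac x)

lemma mass_pos (hG : RatioBounded G1 g) (n : ℕ) (x : E) : 0 < mass M1 G1 n x :=
  ENNReal.toReal_pos (stepKernel_pow_univ hG n x).1 (stepKernel_pow_univ hG n x).2

lemma mass_succ (hG : RatioBounded G1 g) (n : ℕ) (x : E) :
    mass M1 G1 (n + 1) x =
      mass M1 G1 n x * ∫ z, G1 z ∂(fkFlow M1 G1 n (Measure.dirac x)) := by
  have hd := fun n => Measure.dirac_bind (Kernel.measurable (stepKernel M1 G1 ^ n)) x
  have hx := stepKernel_pow_univ (M1 := M1) hG n x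
  rw [mass, ← hd, bind_stepKernel_pow_succ, hd, bind_stepKernel_univ hG.measurable,
    ← integral_eq_lintegral_of_nonneg_ae (ae_of_all _ fun x => (hG.pos x).le)
      hG.measurable.aestronglyMeasurable, fkFlow, hd]
  conv_lhs => rw [← smul_univ_normalize hx.1 hx.2]
  rw [integral_smul_measure, smul_eq_mul, mass]

lemma log_mass (hG : RatioBounded G1 g) (n : ℕ) (x : E) :
    Real.log (mass M1 G1 n x) =
      ∑ k ∈ Finset.range n, Real.log (∫ z, G1 z ∂(fkFlow M1 G1 k (Measure.dirac x))) := by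
  induction n with
  | zero =>
    have : (stepKernel M1 G1 ^ 0) x = Measure.dirac x := Kernel.id_apply x
    rw [mass, this]
    simp
  | succ n ih =>
    have := isProbabilityMeasure_flow (M1 := M1) hG n (Measure.dirac x)
    rw [Finset.sum_range_succ, ← ih, mass_succ hG,
      Real.log_mul (mass_pos hG n x).ne' (hG.integral_pos _).ne']

lemma bind_stepKernel_pow_eq (hG : RatioBounded G1 g) (n : ℕ) (μ : Measure E) :
    Measure.bind μ ⇑(stepKernel M1 G1 ^ n) =
      Measure.bind (μ.withDensity fun x => ENNReal.ofReal (mass M1 G1 n x))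
        (normalizedPow M1 G1 n) := by
  have hm := measurable_normalizedPow (M1 := M1) (G1 := G1) n
  ext s hs
  rw [Measure.bind_apply hs (Kernel.aemeasurable _), Measure.bind_apply hs hm.aemeasurable,
    lintegral_withDensity_eq_lintegral_mul _ (measurable_mass n).ennreal_ofReal
      (show Measurable fun x => normalizedPow M1 G1 n x s from
        (Measure.measurable_coe hs).comp hm)]
  refine lintegral_congr fun x => ?_
  have hx := stepKernel_pow_univ (M1 := M1) hG n x
  simp only [Pi.mul_apply, mass, ENNReal.ofReal_toReal hx.2]
  conv_lhs => rw [← smul_univ_normalize hx.1 hx.2]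
  simp [normalizedPow]

lemma flow_eq_bind (hG : RatioBounded G1 g) (n : ℕ) (μ : Measure E) [IsProbabilityMeasure μ] :
    fkFlow M1 G1 n μ =
      Measure.bind (normalize (μ.withDensity fun x => ENNReal.ofReal (mass M1 G1 n x)))
        (normalizedPow M1 G1 n) := by
  have hw : μ.withDensity (fun x => ENNReal.ofReal (mass M1 G1 n x)) Set.univ =
      Measure.bind μ ⇑(stepKernel M1 G1 ^ n) Set.univ := by
    rw [withDensity_apply _ MeasurableSet.univ, Measure.restrict_univ,
      Measure.bind_apply MeasurableSet.univ (Kernel.aemeasurable _)]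
    exact lintegral_congr fun x => ENNReal.ofReal_toReal (stepKernel_pow_univ hG n x).2
  rw [fkFlow, normalize, normalize, hw, Measure.bind_smul, bind_stepKernel_pow_eq hG]

end Homogeneous

/-! ### Exponential stability -/

section Stability

variable [Nonempty E] {M1 : Kernel E E} [IsMarkovKernel M1] {G1 : E → ℝ} {a r g : ℝ}

lemma sum_geometric_le {C : ℝ} (hC : 0 ≤ C) (hr0 : 0 ≤ r) (hr1 : r < 1) (n : ℕ) :
    ∑ k ∈ Finset.range n, C * r ^ k ≤ C / (1 - r) := by
  have h := (hasSum_geometric_of_lt_one hr0 hr1).mul_left C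
  rw [div_eq_mul_inv, ← h.tsum_eq]
  exact h.summable.sum_le_tsum _ fun k _ => by positivity

lemma mass_ratioBounded (hG : RatioBounded G1 g) (ha : 0 ≤ a) (hr0 : 0 ≤ r) (hr1 : r < 1)
    (hc : Contracts M1 G1 a r) (n : ℕ) :
    RatioBounded (mass M1 G1 n) (Real.exp (g ^ 2 * a / (1 - r))) := by
  refine ⟨measurable_mass n, mass_pos hG n, fun x y => ?_⟩
  have key : Real.log (mass M1 G1 n x) - Real.log (mass M1 G1 n y) ≤ g ^ 2 * a / (1 - r) := by
    rw [log_mass hG, log_mass hG, ← Finset.sum_sub_distrib]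
    refine (Finset.sum_le_sum fun k _ => ?_).trans (sum_geometric_le (by positivity) hr0 hr1 n)
    have := isProbabilityMeasure_flow (M1 := M1) hG k (Measure.dirac x)
    have := isProbabilityMeasure_flow (M1 := M1) hG k (Measure.dirac y)
    refine (hG.log_integral_sub_le _ _).trans ?_
    rw [flow_dirac, flow_dirac, mul_assoc]
    refine mul_le_mul_of_nonneg_left ?_ (sq_nonneg g)
    refine (hc k _ _ inferInstance inferInstance).trans ?_
    exact mul_le_of_le_one_right (by positivity) (tvDist_le_one _ _)
  rw [← Real.log_le_log_iff (mass_pos hG n x) (mul_pos (Real.exp_pos _) (mass_pos hG n y)),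
    Real.log_mul (Real.exp_pos _).ne' (mass_pos hG n y).ne', Real.log_exp]
  linarith

/-- A Lipschitz constant for `μ ↦ log Φ^n(μ)(G)`, up to the factor `r ^ n`. -/
def logLip (a r g : ℝ) : ℝ := g ^ 2 * (a * (2 * Real.exp (g ^ 2 * a / (1 - r)) ^ 2))

lemma logLip_nonneg (ha : 0 ≤ a) : 0 ≤ logLip a r g := by
  unfold logLip
  positivity

lemma abs_log_flow_sub_le (hG : RatioBounded G1 g) (ha : 0 ≤ a) (hr0 : 0 ≤ r) (hr1 : r < 1)
    (hc : Contracts M1 G1 a r) (n : ℕ) (μ ν : Measure E) [IsProbabilityMeasure μ]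
    [IsProbabilityMeasure ν] :
    |Real.log (∫ z, G1 z ∂(fkFlow M1 G1 n μ)) - Real.log (∫ z, G1 z ∂(fkFlow M1 G1 n ν))| ≤
      logLip a r g * tvDist μ ν * r ^ n := by
  have hm := mass_ratioBounded hG ha hr0 hr1 hc n
  have := isProbabilityMeasure_flow (M1 := M1) hG n μ
  have := isProbabilityMeasure_flow (M1 := M1) hG n ν
  refine (hG.abs_log_integral_sub_le _ _).trans ?_
  rw [flow_eq_bind hG, flow_eq_bind hG]
  have h1 := hc n _ _ (hm.isProbabilityMeasure_normalize_withDensity μ)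
    (hm.isProbabilityMeasure_normalize_withDensity ν)
  have h2 := hm.tvDist_normalize_withDensity_le μ ν
  have h3 := h1.trans (mul_le_mul_of_nonneg_left h2 (by positivity))
  refine (mul_le_mul_of_nonneg_left h3 (sq_nonneg g)).trans (le_of_eq ?_)
  rw [logLip]
  ring

lemma summable_and_abs_tsum_le {C : ℝ} {u : ℕ → ℝ} (hr0 : 0 ≤ r) (hr1 : r < 1)
    (hu : ∀ n, |u n| ≤ C * r ^ n) : Summable u ∧ |∑' n, u n| ≤ C / (1 - r) := by
  have h := (hasSum_geometric_of_lt_one hr0 hr1).mul_left C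
  refine ⟨Summable.of_norm_bounded h.summable hu, ?_⟩
  rw [div_eq_mul_inv]
  exact tsum_of_norm_bounded (f := u) h hu

lemma abs_exp_sub_exp_le {x y K : ℝ} (hx : x ≤ K) (hy : y ≤ K) :
    |Real.exp x - Real.exp y| ≤ Real.exp K * |x - y| := by
  wlog hxy : y ≤ x generalizing x y
  · rw [abs_sub_comm, abs_sub_comm x]
    exact this hy hx (le_of_not_ge hxy)
  have h1 := Real.add_one_le_exp (y - x)
  have h2 : Real.exp y = Real.exp x * Real.exp (y - x) := by rw [← Real.exp_add]; ring_nf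
  rw [abs_of_nonneg (sub_nonneg.2 (Real.exp_le_exp.2 hxy)), abs_of_nonneg (sub_nonneg.2 hxy)]
  calc Real.exp x - Real.exp y = Real.exp x * (1 - Real.exp (y - x)) := by rw [h2, mul_sub, mul_one]
    _ ≤ Real.exp x * (x - y) := mul_le_mul_of_nonneg_left (by linarith) (Real.exp_pos _).le
    _ ≤ Real.exp K * (x - y) := by gcongr

/-- The exponentiated series centred at `μ` and at `ν` differ by at most a constant times
the total variation distance of `μ` and `ν`. -/
lemma abs_exp_tsum_sub_le (hG : RatioBounded G1 g) (ha : 0 ≤ a) (hr0 : 0 ≤ r) (hr1 : r < 1)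
    (hc : Contracts M1 G1 a r) (x : E) (μ ν : Measure E) [IsProbabilityMeasure μ]
    [IsProbabilityMeasure ν] :
    |Real.exp (∑' n, (Real.log (∫ z, G1 z ∂(fkFlow M1 G1 n (Measure.dirac x))) -
          Real.log (∫ z, G1 z ∂(fkFlow M1 G1 n μ)))) -
        Real.exp (∑' n, (Real.log (∫ z, G1 z ∂(fkFlow M1 G1 n (Measure.dirac x))) -
          Real.log (∫ z, G1 z ∂(fkFlow M1 G1 n ν))))| ≤
      Real.exp (logLip a r g / (1 - r)) * (logLip a r g / (1 - r)) * tvDist μ ν := by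
  have hL : 0 ≤ logLip a r g := logLip_nonneg ha
  have hterm : ∀ ρ : Measure E, IsProbabilityMeasure ρ → ∀ n,
      |Real.log (∫ z, G1 z ∂(fkFlow M1 G1 n (Measure.dirac x))) -
        Real.log (∫ z, G1 z ∂(fkFlow M1 G1 n ρ))| ≤ logLip a r g * r ^ n := fun ρ _ n => by
    refine (abs_log_flow_sub_le hG ha hr0 hr1 hc n _ _).trans ?_
    gcongr
    exact mul_le_of_le_one_right hL (tvDist_le_one _ _)
  obtain ⟨sμ, bμ⟩ := summable_and_abs_tsum_le hr0 hr1 (hterm μ inferInstance)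
  obtain ⟨sν, bν⟩ := summable_and_abs_tsum_le hr0 hr1 (hterm ν inferInstance)
  refine (abs_exp_sub_exp_le ((le_abs_self _).trans bμ) ((le_abs_self _).trans bν)).trans ?_
  rw [← sμ.tsum_sub sν, mul_assoc]
  gcongr
  refine (summable_and_abs_tsum_le (C := logLip a r g * tvDist ν μ) hr0 hr1 fun n => ?_).2.trans
    (le_of_eq ?_)
  · rw [sub_sub_sub_cancel_left]
    exact abs_log_flow_sub_le hG ha hr0 hr1 hc n ν μ
  · rw [tvDist_comm ν μ]
    ring

end Stability

universe u

/-- Proposition p:cv-Qinfini-h: in the time-homogeneous case,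
Q̄_{p,∞}(1) converges exponentially fast to the ground state h; the constant c
depends only on a, λ, g. -/
theorem statement_5 (a lam g : ℝ) (hlam : 0 < lam) :
    ∃ c : ℝ, ∀ (E : Type u) [MeasurableSpace E] [Nonempty E]
      (M1 : Kernel E E), IsMarkovKernel M1 →
      ∀ G1 : E → ℝ, Measurable G1 →
      ∀ η0 : Measure E, IsProbabilityMeasure η0 →
      (∀ x, 0 < G1 x) → (∀ x y, G1 x ≤ g * G1 y) →
      (∀ p n : ℕ, p ≤ n → ∀ μ ν : Measure E, IsProbabilityMeasure μ →
        IsProbabilityMeasure ν →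
        tvDist (Measure.bind μ (PFK (fun _ => M1) (fun _ => G1) p n))
            (Measure.bind ν (PFK (fun _ => M1) (fun _ => G1) p n)) ≤
          a * Real.exp (-lam * ((n : ℝ) - p)) * tvDist μ ν) →
      ∀ ηinf : Measure E, IsProbabilityMeasure ηinf →
      PhiHom M1 G1 ηinf = ηinf →
      (∀ n : ℕ, tvDist ((PhiHom M1 G1)^[n] η0) ηinf ≤
        a * Real.exp (a * (g - 1) / (1 - Real.exp (-lam))) * Real.exp (-lam * n)) →
      ∀ p : ℕ, ∀ x : E,
        |QbarInf (fun _ => M1) (fun _ => G1) η0 p x - hHom M1 G1 ηinf x| ≤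
          c * Real.exp (-lam * p) := by


  set r : ℝ := Real.exp (-lam) with hr
  have hr0 : 0 ≤ r := (Real.exp_pos _).le
  have hr1 : r < 1 := by simpa [hr] using hlam
  set K : ℝ := logLip |a| r g / (1 - r) with hK
  have hK0 : 0 ≤ K := div_nonneg (logLip_nonneg (abs_nonneg a)) (by linarith)
  refine ⟨Real.exp K * K * (|a| * Real.exp (a * (g - 1) / (1 - r))), ?_⟩
  intro E _ _ M1 _ G1 hGm η0 _ hGpos hGratio hcontr ηinf _ _ hηinf p x
  have hG : RatioBounded G1 g := ⟨hGm, hGpos, hGratio⟩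
  have hexp : ∀ n : ℕ, Real.exp (-lam * n) = r ^ n := fun n => by
    rw [hr, ← Real.exp_nat_mul, mul_comm]
  have hPFK : ∀ n : ℕ, PFK (fun _ => M1) (fun _ => G1) 0 n = normalizedPow M1 G1 n := fun n => by
    funext y
    rw [PFK, normalizedPow, ← Qmeas_eq_stepKernel_pow hGm n 0, zero_add]
  have hc : Contracts M1 G1 |a| r := fun n μ ν hμ hν => by
    have h := hcontr 0 n (Nat.zero_le n) μ ν hμ hν
    rw [hPFK, Nat.cast_zero, sub_zero, hexp] at h
    refine h.trans ?_
    gcongr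
    · exact tvDist_nonneg μ ν
    · exact le_abs_self a
  have hη : etaFK (fun _ => M1) (fun _ => G1) η0 p = fkFlow M1 G1 p η0 := by
    rw [etaFK, fkFlow, ← Qmeas_eq_stepKernel_pow hGm p 0, zero_add]
  have := isProbabilityMeasure_flow (M1 := M1) hG p η0
  have hmain := abs_exp_tsum_sub_le hG (abs_nonneg a) hr0 hr1 hc x (fkFlow M1 G1 p η0) ηinf
  have htv := hηinf p
  rw [iterate_PhiHom hG, hexp] at htv
  simp only [QbarInf, logTermFK, hHom, PhiFK_eq_flow hGm, hη, iterate_PhiHom hG]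
  refine hmain.trans ?_
  rw [hexp, mul_assoc (Real.exp K * K)]
  refine mul_le_mul_of_nonneg_left (htv.trans ?_) (mul_nonneg (Real.exp_pos _).le hK0)
  gcongr
  exact le_abs_self a

end FKCLT
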